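/- Let a be the potential kernel of two-dimensional simple random walk, satisfying a(x) = (2/π) ln‖x‖ + γ' + O(‖x‖^{−2}) as ‖x‖ → ∞. Let 𝒱^α be the vacant set of two-dimensional random interlacements at level α, so that P[x ∈ 𝒱^α] = exp(−(πα/2)a(x)). Then as r → ∞: (i) if 0 < α < 2, E|𝒱^α ∩ B(r)| ∼ (2π/(2−α)) e^{−γ'πα/2} r^{2−α}; (ii) if α = 2, E|𝒱^α ∩ B(r)| ∼ 2π e^{−γ'πα/2} ln r; (iii) if α > 2, E|𝒱^α ∩ B(r)| converges to a finite constant. -/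

import Mathlib

open Filter

/-- Euclidean norm of a lattice point. -/
noncomputable def enorm2 (x : ℤ × ℤ) : ℝ := Real.sqrt ((x.1 : ℝ) ^ 2 + (x.2 : ℝ) ^ 2)

/-- The lattice ball `B(r) = {x ∈ ℤ² : ‖x‖ ≤ r}` as a finite set. -/
noncomputable def latticeBall (r : ℝ) : Finset (ℤ × ℤ) :=
  (Finset.Icc (-⌈r⌉, -⌈r⌉) (⌈r⌉, ⌈r⌉)).filter fun x => enorm2 x ≤ r

lemma mem_latticeBall {r : ℝ} {x : ℤ × ℤ} : x ∈ latticeBall r ↔ enorm2 x ≤ r := by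
  refine ⟨fun h => (Finset.mem_filter.1 h).2, fun h => Finset.mem_filter.2 ⟨?_, h⟩⟩
  have h1 : |(x.1 : ℝ)| ≤ ⌈r⌉ := by
    refine le_trans ?_ (h.trans (Int.le_ceil r))
    exact Real.abs_le_sqrt (le_add_of_nonneg_right (sq_nonneg _))
  have h2 : |(x.2 : ℝ)| ≤ ⌈r⌉ := by
    refine le_trans ?_ (h.trans (Int.le_ceil r))
    exact Real.abs_le_sqrt (le_add_of_nonneg_left (sq_nonneg _))
  rw [abs_le] at h1 h2
  refine Finset.mem_Icc.2 ⟨⟨?_, ?_⟩, ⟨?_, ?_⟩⟩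
  · exact_mod_cast h1.1
  · exact_mod_cast h2.1
  · exact_mod_cast h1.2
  · exact_mod_cast h2.2

/-- The closed Euclidean unit disc in `Fin 2 → ℝ`. -/
def unitDisc : Set (Fin 2 → ℝ) := {v | v 0 ^ 2 + v 1 ^ 2 ≤ 1}

lemma unitDisc_eq_preimage :
    unitDisc = WithLp.toLp 2 ⁻¹' Metric.closedBall (0 : EuclideanSpace ℝ (Fin 2)) 1 := by
  ext v
  simp [unitDisc, EuclideanSpace.norm_eq]

lemma volume_real_unitDisc : MeasureTheory.volume.real unitDisc = Real.pi := by
  rw [unitDisc_eq_preimage, MeasureTheory.measureReal_def,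
    (PiLp.volume_preserving_toLp (Fin 2)).measure_preimage
      measurableSet_closedBall.nullMeasurableSet]
  simp [Real.pi_pos.le]

lemma isCompact_unitDisc : IsCompact unitDisc := by
  rw [unitDisc_eq_preimage]
  exact (EuclideanSpace.equiv (Fin 2) ℝ).symm.toHomeomorph.isCompact_preimage.2
    (isCompact_closedBall _ _)

lemma convex_unitDisc : Convex ℝ unitDisc := by
  rw [unitDisc_eq_preimage]
  exact (convex_closedBall _ _).linear_preimage
    (EuclideanSpace.equiv (Fin 2) ℝ).symm.toLinearMap

open scoped Pointwise in
lemma card_unitDisc_inter_lattice {r : ℝ} (hr : 0 < r) :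
    Nat.card ↑(unitDisc ∩ r⁻¹ • (Submodule.span ℤ (Set.range (Pi.basisFun ℝ (Fin 2))) :
      Set (Fin 2 → ℝ))) = (latticeBall r).card := by
  have key : unitDisc ∩ r⁻¹ • (Submodule.span ℤ (Set.range (Pi.basisFun ℝ (Fin 2))) :
      Set (Fin 2 → ℝ)) = (fun x : ℤ × ℤ => r⁻¹ • ![(x.1 : ℝ), (x.2 : ℝ)]) '' (latticeBall r) := by
    ext v
    rw [Set.mem_inter_iff, Set.mem_smul_set, Set.mem_image]
    have scale (p q : ℝ) : r⁻¹ • ![p, q] ∈ unitDisc ↔ Real.sqrt (p ^ 2 + q ^ 2) ≤ r := by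
      rw [Real.sqrt_le_left hr.le]
      simp only [unitDisc, Set.mem_ofPred_eq, Pi.smul_apply, smul_eq_mul, Matrix.cons_val_zero,
        Matrix.cons_val_one]
      rw [← div_le_one (by positivity : 0 < r ^ 2)]
      field_simp
    constructor
    · rintro ⟨hv, w, hw, rfl⟩
      rw [SetLike.mem_coe, Module.Basis.mem_span_iff_repr_mem] at hw
      obtain ⟨m, hm⟩ := hw 0
      obtain ⟨n, hn⟩ := hw 1
      have hwmn : w = ![(m : ℝ), (n : ℝ)] := by
        ext i
        fin_cases i
        · simpa using hm.symm
        · simpa using hn.symm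
      subst hwmn
      exact ⟨(m, n), mem_latticeBall.2 ((scale _ _).1 hv), rfl⟩
    · rintro ⟨x, hx, rfl⟩
      refine ⟨(scale _ _).2 (mem_latticeBall.1 hx), _, ?_, rfl⟩
      rw [SetLike.mem_coe, Module.Basis.mem_span_iff_repr_mem]
      intro i
      fin_cases i
      · exact ⟨x.1, by simp⟩
      · exact ⟨x.2, by simp⟩
  rw [key, Nat.card_image_of_injective, Nat.card_coe_set_eq, Set.ncard_coe_finset]
  intro x y hxy
  have h := smul_right_injective (Fin 2 → ℝ) (inv_ne_zero hr.ne') hxy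
  have h0 := congrFun h 0
  have h1 := congrFun h 1
  simp only [Matrix.cons_val_zero, Matrix.cons_val_one, Int.cast_inj] at h0 h1
  exact Prod.ext h0 h1

/-- Gauss circle asymptotics. -/
lemma tendsto_card_latticeBall_div_sq :
    Tendsto (fun r : ℝ => ((latticeBall r).card : ℝ) / r ^ 2) atTop (nhds Real.pi) := by
  have h := tendsto_card_div_pow_atTop_volume' unitDisc isCompact_unitDisc.isBounded
    isCompact_unitDisc.measurableSet (convex_unitDisc.addHaar_frontier _)
    (fun x y hx hxy => by
      rintro _ ⟨v, hv, rfl⟩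
      refine ⟨(x / y) • v, ?_, ?_⟩
      · have hy := hx.trans_le hxy
        have : (x / y) ^ 2 ≤ 1 := pow_le_one₀ (by positivity) ((div_le_one hy).2 hxy)
        simp only [unitDisc, Set.mem_ofPred_eq, Pi.smul_apply, smul_eq_mul] at hv ⊢
        nlinarith [sq_nonneg (x / y), sq_nonneg (v 0), sq_nonneg (v 1)]
      · have hy := hx.trans_le hxy
        simp only [smul_smul]
        rw [mul_div_cancel₀ _ hy.ne'])
  rw [volume_real_unitDisc] at h
  refine h.congr' ?_
  filter_upwards [eventually_gt_atTop 0] with r hr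
  rw [card_unitDisc_inter_lattice hr, Fintype.card_fin]

open Asymptotics in
/-- Abelian weighted means: if the plain means of `c` converge to `L`, so do the means weighted
by a slowly decaying `u`. -/
lemma tendsto_weighted_mean {c u : ℕ → ℝ} {L : ℝ} (hu : Antitone u) (hu0 : ∀ n, 0 ≤ u n)
    (hmono : Monotone fun n : ℕ => ((n : ℝ) + 1) * u n)
    (hdiv : Tendsto (fun n => ∑ i ∈ Finset.range n, u i) atTop atTop)
    (hc : Tendsto (fun n : ℕ => (∑ i ∈ Finset.range n, c i) / n) atTop (nhds L)) :
    Tendsto (fun n => (∑ i ∈ Finset.range n, c i * u i) / ∑ i ∈ Finset.range n, u i)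
      atTop (nhds L) := by
  set D : ℕ → ℝ := fun n => ∑ i ∈ Finset.range n, (c i - L) with hD
  have hDo : D =o[atTop] fun n : ℕ => (n : ℝ) := by
    rw [isLittleO_iff_tendsto' (by
      filter_upwards [eventually_gt_atTop 0] with n hn h0
      exact absurd (Nat.cast_eq_zero.1 h0) hn.ne')]
    have h := hc.sub_const L
    rw [sub_self] at h
    refine h.congr' ?_
    filter_upwards [eventually_gt_atTop 0] with n hn
    have : (n : ℝ) ≠ 0 := Nat.cast_ne_zero.2 hn.ne'
    simp only [hD, Finset.sum_sub_distrib, Finset.sum_const, Finset.card_range, nsmul_eq_mul]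
    field_simp
  have parts (n : ℕ) : ∑ i ∈ Finset.range n, (c i - L) * u i =
      D n * u n + ∑ i ∈ Finset.range n, D (i + 1) * (u i - u (i + 1)) := by
    induction n with
    | zero => simp [hD]
    | succ n ih =>
      rw [Finset.sum_range_succ, ih, Finset.sum_range_succ]
      have : D (n + 1) = D n + (c n - L) := Finset.sum_range_succ _ _
      rw [this]
      ring
  have hfirst : (fun n => D n * u n) =o[atTop] fun n => ∑ i ∈ Finset.range n, u i := by
    refine (hDo.mul_isBigO (isBigO_refl u atTop)).trans_isBigO (IsBigO.of_bound 1 ?_)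
    refine Eventually.of_forall fun n => ?_
    have h : (n : ℝ) * u n ≤ ∑ i ∈ Finset.range n, u i := by
      have := Finset.card_nsmul_le_sum (Finset.range n) u (u n)
        fun i hi => hu (Finset.mem_range.1 hi).le
      simpa using this
    have h0 : 0 ≤ (n : ℝ) * u n := mul_nonneg n.cast_nonneg (hu0 n)
    rw [Real.norm_of_nonneg h0, Real.norm_of_nonneg (h0.trans h), one_mul]
    exact h
  have hsecond : (fun n => ∑ i ∈ Finset.range n, D (i + 1) * (u i - u (i + 1))) =o[atTop]
      fun n => ∑ i ∈ Finset.range n, u i := by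
    refine IsLittleO.sum_range ?_ hu0 hdiv
    have h1 : (fun n => D (n + 1)) =o[atTop] fun n : ℕ => ((n + 1 : ℕ) : ℝ) :=
      hDo.comp_tendsto (tendsto_add_atTop_nat 1)
    refine (h1.mul_isBigO (isBigO_refl (fun n => u n - u (n + 1)) atTop)).trans_isBigO
      (IsBigO.of_bound 1 ?_)
    refine Eventually.of_forall fun n => ?_
    have hstep : 0 ≤ u n - u (n + 1) := sub_nonneg.2 (hu n.le_succ)
    have hm := hmono n.le_succ
    simp only [Nat.succ_eq_add_one] at hm
    push_cast at hm ⊢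
    rw [Real.norm_of_nonneg (mul_nonneg (by positivity) hstep), Real.norm_of_nonneg (hu0 n)]
    nlinarith
  have hall := (hfirst.add hsecond).tendsto_div_nhds_zero.add_const L
  rw [zero_add] at hall
  refine hall.congr' ?_
  filter_upwards [hdiv.eventually_gt_atTop 0] with n hn
  rw [← parts, div_add' _ _ _ hn.ne']
  congr 1
  rw [Finset.mul_sum, ← Finset.sum_add_distrib]
  exact Finset.sum_congr rfl fun i _ => by ring

lemma mul_sum_rpow_le {s : ℝ} (h0 : 0 < s) (h1 : s ≤ 1) (n : ℕ) :
    s * ∑ i ∈ Finset.range n, ((i : ℝ) + 1) ^ (s - 1) ≤ (n : ℝ) ^ s := by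
  induction n with
  | zero => simp [h0.ne']
  | succ n ih =>
    rw [Finset.sum_range_succ, mul_add]
    have hn : (0 : ℝ) < n + 1 := by positivity
    have hb := rpow_one_add_le_one_add_mul_self (s := -1 / ((n : ℝ) + 1))
      (by rw [le_div_iff₀ hn]; linarith [(Nat.cast_nonneg n : (0 : ℝ) ≤ n)]) h0.le h1
    have hle := mul_le_mul_of_nonneg_left hb (Real.rpow_nonneg hn.le s)
    rw [← Real.mul_rpow hn.le (by
      have : 1 + -1 / ((n : ℝ) + 1) = n / (n + 1) := by field_simp; ring
      rw [this]; positivity)] at hle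
    rw [show ((n : ℝ) + 1) * (1 + -1 / ((n : ℝ) + 1)) = n by field_simp; ring] at hle
    have hr : ((n : ℝ) + 1) ^ (s - 1) = ((n : ℝ) + 1) ^ s / (n + 1) := Real.rpow_sub_one hn.ne' s
    have : ((n : ℝ) + 1) ^ s * (1 + s * (-1 / ((n : ℝ) + 1))) =
      ((n : ℝ) + 1) ^ s - s * (((n : ℝ) + 1) ^ s / (n + 1)) := by ring
    push_cast
    rw [hr]
    linarith

lemma le_mul_sum_rpow {s : ℝ} (h0 : 0 < s) (h1 : s ≤ 1) (n : ℕ) :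
    ((n : ℝ) + 1) ^ s - 1 ≤ s * ∑ i ∈ Finset.range n, ((i : ℝ) + 1) ^ (s - 1) := by
  induction n with
  | zero => simp
  | succ n ih =>
    rw [Finset.sum_range_succ, mul_add]
    have hn : (0 : ℝ) < n + 1 := by positivity
    have hb := rpow_one_add_le_one_add_mul_self (s := 1 / ((n : ℝ) + 1))
      (by linarith [show 0 ≤ 1 / ((n : ℝ) + 1) by positivity]) h0.le h1
    have hle := mul_le_mul_of_nonneg_left hb (Real.rpow_nonneg hn.le s)
    rw [← Real.mul_rpow hn.le (by positivity)] at hle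
    rw [show ((n : ℝ) + 1) * (1 + 1 / ((n : ℝ) + 1)) = n + 1 + 1 by field_simp] at hle
    have hr : ((n : ℝ) + 1) ^ (s - 1) = ((n : ℝ) + 1) ^ s / (n + 1) := Real.rpow_sub_one hn.ne' s
    have : ((n : ℝ) + 1) ^ s * (1 + s * (1 / ((n : ℝ) + 1))) =
      ((n : ℝ) + 1) ^ s + s * (((n : ℝ) + 1) ^ s / (n + 1)) := by ring
    push_cast
    rw [hr]
    linarith

lemma tendsto_sum_rpow_floor_div {s : ℝ} (h0 : 0 < s) (h1 : s ≤ 1) :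
    Tendsto (fun R : ℝ => (∑ i ∈ Finset.range ⌊R⌋₊, ((i : ℝ) + 1) ^ (s - 1)) / R ^ s) atTop
      (nhds (1 / s)) := by
  have hinv : Tendsto (fun R : ℝ => (R ^ s)⁻¹) atTop (nhds 0) :=
    (tendsto_rpow_atTop h0).inv_tendsto_atTop
  have hlow : Tendsto (fun R : ℝ => (1 - (R ^ s)⁻¹) / s) atTop (nhds (1 / s)) := by
    simpa using (hinv.const_sub 1).div_const s
  refine tendsto_of_tendsto_of_tendsto_of_le_of_le' hlow tendsto_const_nhds ?_ ?_
  · filter_upwards [eventually_gt_atTop 0] with R hR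
    have hRs : 0 < R ^ s := Real.rpow_pos_of_pos hR s
    have h := (sub_le_sub_right (Real.rpow_le_rpow hR.le (Nat.lt_floor_add_one R).le h0.le) 1).trans
      (le_mul_sum_rpow h0 h1 ⌊R⌋₊)
    rw [div_le_div_iff₀ h0 hRs, sub_mul, inv_mul_cancel₀ hRs.ne']
    linarith
  · filter_upwards [eventually_gt_atTop 0] with R hR
    have hRs : 0 < R ^ s := Real.rpow_pos_of_pos hR s
    have h := (mul_sum_rpow_le h0 h1 ⌊R⌋₊).trans
      (Real.rpow_le_rpow (Nat.cast_nonneg _) (Nat.floor_le hR.le) h0.le)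
    rw [div_le_div_iff₀ hRs h0]
    linarith

lemma sum_inv_eq_harmonic (n : ℕ) :
    ∑ i ∈ Finset.range n, ((i : ℝ) + 1) ^ (-1 : ℝ) = (harmonic n : ℝ) := by
  simp [harmonic, Real.rpow_neg_one]

lemma tendsto_sum_inv_floor_div_log :
    Tendsto (fun R : ℝ => (∑ i ∈ Finset.range ⌊R⌋₊, ((i : ℝ) + 1) ^ (-1 : ℝ)) / Real.log R) atTop
      (nhds 1) := by
  have hup : Tendsto (fun R : ℝ => (Real.log R)⁻¹ + 1) atTop (nhds 1) := by
    simpa using Real.tendsto_log_atTop.inv_tendsto_atTop.add_const 1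
  refine tendsto_of_tendsto_of_tendsto_of_le_of_le' tendsto_const_nhds hup ?_ ?_
  · filter_upwards [eventually_gt_atTop 1] with R hR
    rw [sum_inv_eq_harmonic, le_div_iff₀ (Real.log_pos hR), one_mul]
    exact log_le_harmonic_floor R (by linarith)
  · filter_upwards [eventually_gt_atTop 1] with R hR
    have hl := Real.log_pos hR
    rw [sum_inv_eq_harmonic, div_le_iff₀ hl, add_mul, inv_mul_cancel₀ hl.ne', one_mul]
    exact harmonic_floor_le_one_add_log R hR.le

lemma tendsto_sum_rpow_atTop {b : ℝ} (hb : b ≤ 1) :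
    Tendsto (fun n : ℕ => ∑ i ∈ Finset.range n, ((i : ℝ) + 1) ^ (-b)) atTop atTop := by
  rw [← not_summable_iff_tendsto_nat_atTop_of_nonneg (fun i => by positivity)]
  intro h
  have h' : Summable fun i : ℕ => ((i + 1 : ℕ) : ℝ) ^ (-b) := by simpa using h
  rw [summable_nat_add_iff 1 (f := fun i : ℕ => (i : ℝ) ^ (-b)), Real.summable_nat_rpow] at h'
  linarith

lemma tendsto_rpow_weighted_mean {c : ℕ → ℝ} {L b : ℝ} (hb0 : 0 ≤ b) (hb : b ≤ 1)
    (hc : Tendsto (fun n : ℕ => (∑ i ∈ Finset.range n, c i) / n) atTop (nhds L)) :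
    Tendsto (fun n => (∑ i ∈ Finset.range n, c i * ((i : ℝ) + 1) ^ (-b)) /
      ∑ i ∈ Finset.range n, ((i : ℝ) + 1) ^ (-b)) atTop (nhds L) := by
  refine tendsto_weighted_mean (u := fun i : ℕ => ((i : ℝ) + 1) ^ (-b)) ?_ (fun n => by positivity)
    ?_ (tendsto_sum_rpow_atTop hb) hc
  · intro m n hmn
    exact Real.rpow_le_rpow_of_nonpos (by positivity) (by gcongr) (by linarith)
  · intro m n hmn
    have key (k : ℕ) : ((k : ℝ) + 1) * ((k : ℝ) + 1) ^ (-b) = ((k : ℝ) + 1) ^ (1 - b) := by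
      rw [sub_eq_add_neg, Real.rpow_add (by positivity), Real.rpow_one]
    simp only [key]
    exact Real.rpow_le_rpow (by positivity) (by gcongr) (by linarith)

/-- The squared Euclidean norm of a lattice point, as a natural number. -/
def normSqNat (x : ℤ × ℤ) : ℕ := x.1.natAbs ^ 2 + x.2.natAbs ^ 2

lemma cast_normSqNat (x : ℤ × ℤ) : (normSqNat x : ℝ) = (x.1 : ℝ) ^ 2 + (x.2 : ℝ) ^ 2 := by
  simp [normSqNat, Nat.cast_natAbs]

lemma enorm2_eq_sqrt (x : ℤ × ℤ) : enorm2 x = Real.sqrt (normSqNat x) := by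
  rw [cast_normSqNat, enorm2]

lemma enorm2_sq (x : ℤ × ℤ) : enorm2 x ^ 2 = normSqNat x := by
  rw [enorm2_eq_sqrt, Real.sq_sqrt (Nat.cast_nonneg _)]

lemma normSqNat_eq_zero {x : ℤ × ℤ} : normSqNat x = 0 ↔ x = 0 := by
  simp [normSqNat, Prod.ext_iff]

lemma enorm2_le_iff {r : ℝ} (hr : 0 ≤ r) {x : ℤ × ℤ} : enorm2 x ≤ r ↔ normSqNat x ≤ ⌊r ^ 2⌋₊ := by
  rw [enorm2_eq_sqrt, Real.sqrt_le_left hr, Nat.le_floor_iff (sq_nonneg r)]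

/-- The lattice points with squared norm `k`. -/
noncomputable def latticeShell (k : ℕ) : Finset (ℤ × ℤ) :=
  (latticeBall (Real.sqrt k)).filter fun x => normSqNat x = k

lemma mem_latticeShell {k : ℕ} {x : ℤ × ℤ} : x ∈ latticeShell k ↔ normSqNat x = k := by
  rw [latticeShell, Finset.mem_filter, mem_latticeBall, enorm2_eq_sqrt]
  exact ⟨fun h => h.2, fun h => ⟨by rw [h], h⟩⟩

lemma sum_latticeBall_eq {r : ℝ} (hr : 0 ≤ r) (F : ℤ × ℤ → ℝ) :
    ∑ x ∈ latticeBall r, F x =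
      F 0 + ∑ i ∈ Finset.range ⌊r ^ 2⌋₊, ∑ x ∈ latticeShell (i + 1), F x := by
  have hmaps : ∀ x ∈ latticeBall r, normSqNat x ∈ Finset.range (⌊r ^ 2⌋₊ + 1) := fun x hx =>
    Finset.mem_range_succ_iff.2 ((enorm2_le_iff hr).1 (mem_latticeBall.1 hx))
  have hfib : ∀ k ∈ Finset.range (⌊r ^ 2⌋₊ + 1),
      (latticeBall r).filter (fun x => normSqNat x = k) = latticeShell k := by
    intro k hk
    ext x
    rw [Finset.mem_filter, mem_latticeShell, mem_latticeBall, enorm2_le_iff hr]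
    exact ⟨fun h => h.2, fun h => ⟨h ▸ Finset.mem_range_succ_iff.1 hk, h⟩⟩
  have hzero : latticeShell 0 = {0} := by
    ext x
    rw [mem_latticeShell, normSqNat_eq_zero, Finset.mem_singleton]
  rw [← Finset.sum_fiberwise_of_maps_to hmaps, Finset.sum_congr rfl fun k hk => by rw [hfib k hk],
    Finset.sum_range_succ', hzero, Finset.sum_singleton, add_comm]

lemma tendsto_sum_card_latticeShell_div :
    Tendsto (fun n : ℕ => (∑ i ∈ Finset.range n, ((latticeShell (i + 1)).card : ℝ)) / n) atTop
      (nhds Real.pi) := by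
  have hsqrt : Tendsto (fun n : ℕ => Real.sqrt n) atTop atTop :=
    Real.tendsto_sqrt_atTop.comp tendsto_natCast_atTop_atTop
  have hinv : Tendsto (fun n : ℕ => ((n : ℝ))⁻¹) atTop (nhds 0) :=
    tendsto_natCast_atTop_atTop.inv_tendsto_atTop
  have h := (tendsto_card_latticeBall_div_sq.comp hsqrt).sub hinv
  rw [sub_zero] at h
  refine h.congr fun n => ?_
  have hs := sum_latticeBall_eq (Real.sqrt_nonneg n) fun _ => 1
  simp only [Finset.sum_const, nsmul_eq_mul, mul_one, Real.sq_sqrt (Nat.cast_nonneg n),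
    Nat.floor_natCast] at hs
  simp only [Function.comp_apply, Real.sq_sqrt (Nat.cast_nonneg n), hs]
  ring

open Asymptotics in
/-- Shell averages of a function converging to `K` at infinity. -/
lemma tendsto_sum_latticeShell_div {q : ℤ × ℤ → ℝ} {K : ℝ}
    (hq : ∀ ε > 0, ∀ᶠ k : ℕ in atTop, ∀ x ∈ latticeShell k, |q x - K| ≤ ε) :
    Tendsto (fun n : ℕ => (∑ i ∈ Finset.range n, ∑ x ∈ latticeShell (i + 1), q x) / n) atTop
      (nhds (Real.pi * K)) := by
  have hcard := tendsto_sum_card_latticeShell_div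
  set S : ℕ → ℝ := fun n => ∑ i ∈ Finset.range n, ((latticeShell (i + 1)).card : ℝ) with hS
  have hSinf : Tendsto S atTop atTop := by
    refine (hcard.pos_mul_atTop Real.pi_pos tendsto_natCast_atTop_atTop).congr' ?_
    filter_upwards [eventually_gt_atTop 0] with n hn
    exact div_mul_cancel₀ _ (Nat.cast_ne_zero.2 hn.ne')
  have ho : (fun i => ∑ x ∈ latticeShell (i + 1), (q x - K)) =o[atTop]
      fun i => ((latticeShell (i + 1)).card : ℝ) := by
    rw [isLittleO_iff]
    intro ε hε
    filter_upwards [(tendsto_add_atTop_nat 1).eventually (hq ε hε)] with i hi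
    rw [Real.norm_natCast, mul_comm, ← nsmul_eq_mul]
    exact (norm_sum_le _ _).trans (Finset.sum_le_card_nsmul _ _ _ hi)
  have hsum := ho.sum_range (fun i => Nat.cast_nonneg _) hSinf
  have h := (hsum.tendsto_div_nhds_zero.add_const K).mul hcard
  rw [zero_add, mul_comm] at h
  refine h.congr' ?_
  filter_upwards [hSinf.eventually_gt_atTop 0] with n hn
  rw [show ∑ i ∈ Finset.range n, ((latticeShell (i + 1)).card : ℝ) = S n from rfl,
    div_add' _ _ _ hn.ne', div_mul_div_cancel₀ hn.ne']
  congr 1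
  simp only [hS, Finset.sum_sub_distrib, Finset.sum_const, nsmul_eq_mul, ← Finset.sum_mul]
  ring

/-- Sums over balls of a function asymptotic to `K ‖x‖⁻²ᵇ`, compared with `∑ n⁻ᵇ`. -/
lemma tendsto_sum_latticeShell_rpow {F : ℤ × ℤ → ℝ} {K b : ℝ} (hb0 : 0 ≤ b) (hb : b ≤ 1)
    (hF : ∀ ε > 0, ∀ᶠ k : ℕ in atTop, ∀ x ∈ latticeShell k, |F x * (k : ℝ) ^ b - K| ≤ ε) :
    Tendsto (fun n : ℕ => (∑ i ∈ Finset.range n, ∑ x ∈ latticeShell (i + 1), F x) /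
      ∑ i ∈ Finset.range n, ((i : ℝ) + 1) ^ (-b)) atTop (nhds (Real.pi * K)) := by
  have hq := tendsto_sum_latticeShell_div (q := fun x => F x * (normSqNat x : ℝ) ^ b) (K := K)
    fun ε hε => (hF ε hε).mono fun k hk x hx => by
      rw [mem_latticeShell.1 hx]
      exact hk x hx
  refine (tendsto_rpow_weighted_mean hb0 hb hq).congr fun n => ?_
  congr 1
  refine Finset.sum_congr rfl fun i _ => ?_
  rw [Finset.sum_mul]
  refine Finset.sum_congr rfl fun x hx => ?_
  have hi : (0 : ℝ) < (i : ℝ) + 1 := by positivity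
  rw [mem_latticeShell.1 hx, Nat.cast_add_one, mul_assoc, ← Real.rpow_add hi, add_neg_cancel,
    Real.rpow_zero, mul_one]

lemma tendsto_sum_latticeBall_div {F : ℤ × ℤ → ℝ} {G : ℝ → ℝ} {K b l : ℝ} (hb0 : 0 ≤ b)
    (hb : b ≤ 1)
    (hF : ∀ ε > 0, ∀ᶠ k : ℕ in atTop, ∀ x ∈ latticeShell k, |F x * (k : ℝ) ^ b - K| ≤ ε)
    (hG : Tendsto G atTop atTop)
    (hU : Tendsto (fun R : ℝ => (∑ i ∈ Finset.range ⌊R⌋₊, ((i : ℝ) + 1) ^ (-b)) / G R) atTop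
      (nhds l)) :
    Tendsto (fun r : ℝ => (∑ x ∈ latticeBall r, F x) / G (r ^ 2)) atTop
      (nhds (Real.pi * K * l)) := by
  have hsq : Tendsto (fun r : ℝ => r ^ 2) atTop atTop := tendsto_pow_atTop two_ne_zero
  have hfloor : Tendsto (fun r : ℝ => ⌊r ^ 2⌋₊) atTop atTop := tendsto_nat_floor_atTop.comp hsq
  have h0 : Tendsto (fun r : ℝ => F 0 / G (r ^ 2)) atTop (nhds 0) :=
    (hG.comp hsq).const_div_atTop (F 0)
  have h := h0.add (((tendsto_sum_latticeShell_rpow hb0 hb hF).comp hfloor).mul (hU.comp hsq))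
  rw [zero_add] at h
  refine h.congr' ?_
  filter_upwards [eventually_ge_atTop 0,
    ((tendsto_sum_rpow_atTop hb).comp hfloor).eventually_gt_atTop 0] with r hr hpos
  simp only [Function.comp_apply] at hpos ⊢
  rw [sum_latticeBall_eq hr, div_mul_div_cancel₀ hpos.ne', add_div]

lemma summable_of_abs_le_enorm2_rpow {F : ℤ × ℤ → ℝ} {M α : ℝ} (hM : 0 ≤ M) (hα : 2 < α)
    (hF : ∀ x ≠ 0, |F x| ≤ M * enorm2 x ^ (-α)) : Summable F := by
  have hs : Summable fun x : ℤ × ℤ => M * ‖![x.1, x.2]‖ ^ (-α) :=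
    ((finTwoArrowEquiv ℤ).symm.summable_iff.2
      (EisensteinSeries.summable_one_div_norm_rpow hα)).mul_left M
  refine hs.of_norm_bounded_eventually ?_
  filter_upwards [(Set.finite_singleton (0 : ℤ × ℤ)).compl_mem_cofinite] with x hx
  have hx0 : x ≠ 0 := hx
  refine (hF x hx0).trans (mul_le_mul_of_nonneg_left ?_ hM)
  refine Real.rpow_le_rpow_of_nonpos ?_ ?_ (by linarith)
  · refine norm_pos_iff.2 fun h => hx0 ?_
    have h0 := congrFun h 0
    have h1 := congrFun h 1
    simp only [Matrix.cons_val_zero, Matrix.cons_val_one, Pi.zero_apply] at h0 h1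
    exact Prod.ext h0 h1
  · rw [enorm2, pi_norm_le_iff_of_nonneg (Real.sqrt_nonneg _)]
    intro i
    fin_cases i
    · exact Real.abs_le_sqrt (le_add_of_nonneg_right (sq_nonneg _))
    · exact Real.abs_le_sqrt (le_add_of_nonneg_left (sq_nonneg _))

lemma tendsto_latticeBall_atTop : Tendsto latticeBall atTop atTop :=
  tendsto_atTop_finset_of_monotone
    (fun _ _ h _ hx => mem_latticeBall.2 ((mem_latticeBall.1 hx).trans h))
    fun x => ⟨enorm2 x, mem_latticeBall.2 le_rfl⟩

lemma enorm2_pos {x : ℤ × ℤ} (hx : x ≠ 0) : 0 < enorm2 x := by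
  rw [enorm2_eq_sqrt, Real.sqrt_pos, Nat.cast_pos, Nat.pos_iff_ne_zero]
  exact fun h => hx (normSqNat_eq_zero.1 h)

/-- The vacancy probability factorizes as `e^{−γ'πα/2} ‖x‖^{−α}` times an error factor. -/
lemma exp_mul_enorm2_rpow {x : ℤ × ℤ} (hx : x ≠ 0) (t γ' α : ℝ) :
    Real.exp (-(Real.pi * α / 2) * t) * enorm2 x ^ α = Real.exp (-γ' * Real.pi * α / 2) *
      Real.exp (-(Real.pi * α / 2) * (t - ((2 / Real.pi) * Real.log (enorm2 x) + γ'))) := by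
  rw [Real.rpow_def_of_pos (enorm2_pos hx), ← Real.exp_add, ← Real.exp_add]
  congr 1
  field_simp
  ring

/-- Asymptotics of the expected size of the vacant set of two-dimensional
random interlacements in the ball `B(r)`, where `P[x ∈ 𝒱^α] = exp(−(πα/2) a x)` and
`a x = (2/π) ln‖x‖ + γ' + O(‖x‖⁻²)`:  for `α < 2` it is `∼ (2π/(2−α)) e^{−γ'πα/2} r^{2−α}`,
for `α = 2` it is `∼ 2π e^{−γ'πα/2} ln r`, and for `α > 2` it converges to a finite
constant. -/
theorem expected_vacant_set_in_ball
    (a : ℤ × ℤ → ℝ) (γ' C : ℝ) (hC : 0 < C)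
    (haAsymp : ∀ x : ℤ × ℤ, x ≠ 0 →
      |a x - ((2 / Real.pi) * Real.log (enorm2 x) + γ')| ≤ C / enorm2 x ^ 2)
    (α : ℝ) (hα : 0 < α)
    (Pin : ℤ × ℤ → ℝ)  -- `Pin x = P[x ∈ 𝒱^α]`
    (hPin : ∀ x : ℤ × ℤ, Pin x = Real.exp (-(Real.pi * α / 2) * a x)) :
    (α < 2 → Tendsto
        (fun r : ℝ => (∑ x ∈ latticeBall r, Pin x) / r ^ (2 - α))
        atTop (nhds ((2 * Real.pi / (2 - α)) * Real.exp (-γ' * Real.pi * α / 2)))) ∧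
    (α = 2 → Tendsto
        (fun r : ℝ => (∑ x ∈ latticeBall r, Pin x) / Real.log r)
        atTop (nhds (2 * Real.pi * Real.exp (-γ' * Real.pi * α / 2)))) ∧
    (2 < α → ∃ c : ℝ, Tendsto
        (fun r : ℝ => ∑ x ∈ latticeBall r, Pin x) atTop (nhds c)) := by
  have hB : 0 < Real.pi * α / 2 := by positivity
  set K := Real.exp (-γ' * Real.pi * α / 2) with hK
  have hKpos : 0 < K := Real.exp_pos _
  have herr : ∀ x : ℤ × ℤ, x ≠ 0 → ∃ t : ℝ, |t| ≤ Real.pi * α / 2 * C / enorm2 x ^ 2 ∧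
      Pin x * enorm2 x ^ α = K * Real.exp t := by
    intro x hx
    refine ⟨_, ?_, by rw [hPin, exp_mul_enorm2_rpow hx (a x) γ' α]⟩
    rw [abs_mul, abs_neg, abs_of_pos hB, mul_div_assoc _ C]
    exact mul_le_mul_of_nonneg_left (haAsymp x hx) hB.le
  have hF : ∀ ε > 0, ∀ᶠ k : ℕ in atTop, ∀ x ∈ latticeShell k,
      |Pin x * (k : ℝ) ^ (α / 2) - K| ≤ ε := by
    intro ε hε
    have hcont : Tendsto (fun t : ℝ => K * Real.exp t) (nhds 0) (nhds K) := by
      have : Continuous fun t : ℝ => K * Real.exp t := by fun_prop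
      simpa using this.tendsto 0
    obtain ⟨δ, hδ, hclose⟩ := Metric.tendsto_nhds_nhds.1 hcont ε hε
    have hdecay : Tendsto (fun k : ℕ => Real.pi * α / 2 * C / (k : ℝ)) atTop (nhds 0) :=
      tendsto_const_div_atTop_nhds_zero_nat _
    filter_upwards [hdecay.eventually_lt_const hδ, eventually_gt_atTop 0] with k hk hk0 x hx
    have hxk := mem_latticeShell.1 hx
    have hx0 : x ≠ 0 := fun h => hk0.ne' (hxk ▸ normSqNat_eq_zero.2 h)
    obtain ⟨t, ht, hPt⟩ := herr x hx0
    rw [enorm2_sq, hxk] at ht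
    have hpow : enorm2 x ^ α = (k : ℝ) ^ (α / 2) := by
      rw [enorm2_eq_sqrt, hxk, Real.sqrt_eq_rpow, ← Real.rpow_mul (Nat.cast_nonneg k)]
      congr 1
      ring
    rw [← hpow, hPt]
    refine (hclose ?_).le
    rw [Real.dist_eq, sub_zero]
    exact ht.trans_lt hk
  refine ⟨fun h2 => ?_, fun h2 => ?_, fun h2 => ?_⟩
  · have hs : 0 < 1 - α / 2 := by linarith
    have hU := tendsto_sum_rpow_floor_div hs (by linarith)
    rw [show 1 - α / 2 - 1 = -(α / 2) by ring] at hU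
    have h := tendsto_sum_latticeBall_div (by positivity) (by linarith) hF
      (tendsto_rpow_atTop hs) hU
    rw [show 2 * Real.pi / (2 - α) * K = Real.pi * K * (1 / (1 - α / 2)) by
      have : 2 - α ≠ 0 := by linarith
      field_simp]
    refine h.congr' ?_
    filter_upwards [eventually_gt_atTop 0] with r hr
    rw [← Real.rpow_natCast, ← Real.rpow_mul hr.le]
    congr 2
    push_cast
    ring
  · rw [h2, div_self two_ne_zero] at hF
    have h := (tendsto_sum_latticeBall_div zero_le_one le_rfl hF Real.tendsto_log_atTop
      tendsto_sum_inv_floor_div_log).const_mul 2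
    rw [show 2 * Real.pi * K = 2 * (Real.pi * K * 1) by ring]
    refine h.congr fun r => ?_
    rw [Real.log_pow, Nat.cast_two, mul_div_assoc', mul_div_mul_left _ _ two_ne_zero]
  · refine ⟨_, (summable_of_abs_le_enorm2_rpow (α := α)
      (M := K * Real.exp (Real.pi * α / 2 * C)) (by positivity) h2
      fun x hx => ?_).hasSum.comp tendsto_latticeBall_atTop⟩
    obtain ⟨t, ht, hPt⟩ := herr x hx
    have hpos := Real.rpow_pos_of_pos (enorm2_pos hx) α
    have hone : (1 : ℝ) ≤ enorm2 x ^ 2 := by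
      rw [enorm2_sq, Nat.one_le_cast, Nat.one_le_iff_ne_zero]
      exact fun h => hx (normSqNat_eq_zero.1 h)
    have htC : t ≤ Real.pi * α / 2 * C :=
      (le_abs_self t).trans (ht.trans (div_le_self (by positivity) hone))
    rw [abs_of_pos (by rw [hPin]; exact Real.exp_pos _), Real.rpow_neg (enorm2_pos hx).le,
      ← div_eq_mul_inv, le_div_iff₀ hpos, hPt]
    gcongr
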